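/- Let ν ∈ ℝ, let û, U : ℝ × ℝ → ℝ be twice continuously differentiable, let a, u_d : ℝ × ℝ → ℝ be continuous, and let r : ℝ → ℝ be continuously differentiable. Suppose that for all t ≥ 0 and x ∈ [0,1], U satisfies the regulator equation ∂ₜU = ν·∂ₓₓU − U·∂ₓU + a·(û + U) − û·∂ₓû − (û·∂ₓU + U·∂ₓû) + u_d, together with the Neumann boundary conditions ν·∂ₓU(t,0) = F₀(t) and ν·∂ₓU(t,1) = F₁(t), where F₀(t) = û(t,0)·U(t,0) + (1/2)·(û(t,0)² + U(t,0)²) and F₁(t) = û(t,1)·U(t,1) + (1/2)·(û(t,1)² + U(t,1)²) + r'(t) − ∫₀¹ [a(t,x)·(û(t,x) + U(t,x)) + u_d(t,x)] dx. If in addition ∫₀¹ U(0,x) dx = r(0), then ∫₀¹ U(t,x) dx = r(t) for all t ≥ 0. -/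

import Mathlib

/-- Partial derivative in the first (time) variable. -/
noncomputable def pt (w : ℝ × ℝ → ℝ) (t x : ℝ) : ℝ := deriv (fun s => w (s, x)) t

/-- First partial derivative in the second (space) variable. -/
noncomputable def px (w : ℝ × ℝ → ℝ) (t x : ℝ) : ℝ := deriv (fun y => w (t, y)) x

/-- Second partial derivative in the second (space) variable. -/
noncomputable def pxx (w : ℝ × ℝ → ℝ) (t x : ℝ) : ℝ := deriv (fun y => px w t y) x

theorem hasDerivAt_pt {w : ℝ × ℝ → ℝ} (hw : Differentiable ℝ w) (t x : ℝ) :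
    HasDerivAt (fun s => w (s, x)) (fderiv ℝ w (t, x) (1, 0)) t :=
  (hw (t, x)).hasFDerivAt.comp_hasDerivAt t ((hasDerivAt_id t).prodMk (hasDerivAt_const t x))

theorem hasDerivAt_px {w : ℝ × ℝ → ℝ} (hw : Differentiable ℝ w) (t x : ℝ) :
    HasDerivAt (fun y => w (t, y)) (fderiv ℝ w (t, x) (0, 1)) x :=
  (hw (t, x)).hasFDerivAt.comp_hasDerivAt x ((hasDerivAt_const x t).prodMk (hasDerivAt_id x))

theorem pt_eq_fderiv {w : ℝ × ℝ → ℝ} (hw : Differentiable ℝ w) (t x : ℝ) :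
    pt w t x = fderiv ℝ w (t, x) (1, 0) :=
  (hasDerivAt_pt hw t x).deriv

theorem px_eq_fderiv {w : ℝ × ℝ → ℝ} (hw : Differentiable ℝ w) (t x : ℝ) :
    px w t x = fderiv ℝ w (t, x) (0, 1) :=
  (hasDerivAt_px hw t x).deriv

theorem continuous_pt {w : ℝ × ℝ → ℝ} (hw : ContDiff ℝ 1 w) :
    Continuous fun p : ℝ × ℝ => pt w p.1 p.2 := by
  simp only [pt_eq_fderiv (hw.differentiable one_ne_zero)]
  exact (hw.continuous_fderiv one_ne_zero).clm_apply continuous_const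

theorem contDiff_px {w : ℝ × ℝ → ℝ} (hw : ContDiff ℝ 2 w) :
    ContDiff ℝ 1 fun p : ℝ × ℝ => px w p.1 p.2 := by
  simp only [px_eq_fderiv (hw.differentiable two_ne_zero)]
  exact (hw.fderiv_right (by norm_num)).clm_apply contDiff_const

/-- The increment in time of a spatial integral is the integral of the spatial integral of the
time derivative. -/
theorem integral_sub_integral_eq_integral_pt {w : ℝ × ℝ → ℝ} (hw : ContDiff ℝ 1 w)
    (a b s t : ℝ) :
    (∫ x in a..b, w (t, x)) - ∫ x in a..b, w (s, x) =
      ∫ τ in s..t, ∫ x in a..b, pt w τ x := by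
  have hc := continuous_pt hw
  have hd := hw.differentiable one_ne_zero
  have hwc := hw.continuous
  rw [← intervalIntegral.integral_sub
    ((by fun_prop : Continuous fun x => w (t, x)).intervalIntegrable _ _)
    ((by fun_prop : Continuous fun x => w (s, x)).intervalIntegrable _ _),
    MeasureTheory.intervalIntegral_intervalIntegral_swap (F := pt w)
      ((hc.continuousOn.integrableOn_compact (isCompact_uIcc.prod isCompact_uIcc)).mono_set
        (Set.prod_mono Set.uIoc_subset_uIcc Set.uIoc_subset_uIcc))]
  refine intervalIntegral.integral_congr fun x _ => ?_
  refine (intervalIntegral.integral_eq_sub_of_hasDerivAt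
    (f := fun τ => w (τ, x)) (f' := fun τ => pt w τ x) (fun τ _ => ?_) ?_).symm
  · rw [pt_eq_fderiv hd]
    exact hasDerivAt_pt hd τ x
  · exact (hc.comp (Continuous.prodMk_left x)).intervalIntegrable _ _

/-- regulation identity under the feedforward controllers
(controller-F0-new), (controller-F1-new) of Theorem 2, for the regulator
equation (regulator1-new). -/
theorem stmt_12 (ν : ℝ) (uh U a ud : ℝ × ℝ → ℝ) (r : ℝ → ℝ)
    (huh : ContDiff ℝ 2 uh) (hU : ContDiff ℝ 2 U)
    (ha : Continuous a) (hud : Continuous ud) (hr : ContDiff ℝ 1 r)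
    (heq : ∀ t ≥ (0:ℝ), ∀ x ∈ Set.Icc (0:ℝ) 1,
      pt U t x = ν * pxx U t x - U (t, x) * px U t x
        + a (t, x) * (uh (t, x) + U (t, x))
        - uh (t, x) * px uh t x
        - (uh (t, x) * px U t x + U (t, x) * px uh t x) + ud (t, x))
    (hbc0 : ∀ t ≥ (0:ℝ),
      ν * px U t 0 = uh (t, 0) * U (t, 0)
        + (1/2) * ((uh (t, 0)) ^ 2 + (U (t, 0)) ^ 2))
    (hbc1 : ∀ t ≥ (0:ℝ),
      ν * px U t 1 = uh (t, 1) * U (t, 1)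
        + (1/2) * ((uh (t, 1)) ^ 2 + (U (t, 1)) ^ 2) + deriv r t
        - ∫ x in (0:ℝ)..1,
            (a (t, x) * (uh (t, x) + U (t, x)) + ud (t, x)))
    (hic : (∫ x in (0:ℝ)..1, U (0, x)) = r 0) :
    ∀ t ≥ (0:ℝ), (∫ x in (0:ℝ)..1, U (t, x)) = r t := by
  intro t ht
  have hU1 : ContDiff ℝ 1 U := hU.of_le one_le_two
  have hUd := hU1.differentiable one_ne_zero
  have huhd := huh.differentiable two_ne_zero
  have hUc := hU.continuous
  have huhc := huh.continuous
  have key : ∀ τ ≥ (0:ℝ), (∫ x in (0:ℝ)..1, pt U τ x) = deriv r τ := by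
    intro τ hτ
    have hptc : Continuous fun x => pt U τ x :=
      (continuous_pt hU1).comp (Continuous.prodMk_right τ)
    have hsrc : Continuous fun x => a (τ, x) * (uh (τ, x) + U (τ, x)) + ud (τ, x) := by
      fun_prop
    have hflux : ∀ x ∈ Set.uIcc (0:ℝ) 1,
        HasDerivAt (fun y => ν * px U τ y - (1/2) * (uh (τ, y) + U (τ, y)) ^ 2)
          (pt U τ x - (a (τ, x) * (uh (τ, x) + U (τ, x)) + ud (τ, x))) x := by
      intro x hx
      rw [Set.uIcc_of_le zero_le_one] at hx
      have hxx : HasDerivAt (fun y => px U τ y) (pxx U τ x) x :=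
        (hasDerivAt_px ((contDiff_px hU).differentiable one_ne_zero)
          τ x).differentiableAt.hasDerivAt
      have hux := hasDerivAt_px huhd τ x
      have hUx := hasDerivAt_px hUd τ x
      rw [← px_eq_fderiv huhd] at hux
      rw [← px_eq_fderiv hUd] at hUx
      refine ((hxx.const_mul ν).sub (((hux.add hUx).pow 2).const_mul (1/2))).congr_deriv ?_
      rw [heq τ hτ x hx]
      simp only [Pi.add_apply]
      push_cast
      ring
    have hint := intervalIntegral.integral_eq_sub_of_hasDerivAt hflux
      ((hptc.sub hsrc).intervalIntegrable _ _)
    rw [intervalIntegral.integral_sub (hptc.intervalIntegrable _ _)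
      (hsrc.intervalIntegrable _ _)] at hint
    linear_combination hint + hbc1 τ hτ - hbc0 τ hτ
  have hinc := integral_sub_integral_eq_integral_pt hU1 0 1 0 t
  have hr' : (∫ τ in (0:ℝ)..t, ∫ x in (0:ℝ)..1, pt U τ x) = r t - r 0 := by
    rw [← intervalIntegral.integral_deriv_eq_sub
      (fun τ _ => hr.differentiable one_ne_zero τ)
      ((hr.continuous_deriv le_rfl).intervalIntegrable _ _)]
    refine intervalIntegral.integral_congr fun τ hτ => key τ ?_
    rw [Set.uIcc_of_le ht] at hτ
    exact hτ.1
  linarith
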